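/- Let C be an m×n Cauchon diagram, let k ∈ [n] with (1,1) ≺ (m,k), and let (i,j) satisfy i ≤ m−1 and j ≤ k−1. Then T^{(m,k)}[i,j] = T^{(m,k)⁻}[i,j] + Σ_P w(P), where the sum is over all directed paths P from r_i to c_j in the Cauchon graph G_C satisfying: (1) P contains the subpath K_j from (m,k) to c_j consisting of horizontal edges in row m from (m,k) to (m,j) followed by the edge from (m,j) to c_j, and (2) P reaches (m,k) by a vertical edge, i.e., P contains an edge from some white square (ℓ,k) with ℓ < m to (m,k). -/

import Mathlib

universe u

/-- Quantum affine space data: a central unit `q` and units `t i j`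
satisfying the quantum affine space commutation relations. -/
structure QMData (R : Type u) [Ring R] (m n : ℕ) where
  q : Rˣ
  t : Fin m → Fin n → Rˣ
  q_central : ∀ r : R, (q : R) * r = r * (q : R)
  row_rel : ∀ (i : Fin m) ⦃j j' : Fin n⦄, j < j' →
    (t i j : R) * (t i j' : R) = (q : R) * ((t i j' : R) * (t i j : R))
  col_rel : ∀ ⦃i i' : Fin m⦄ (j : Fin n), i < i' →
    (t i j : R) * (t i' j : R) = (q : R) * ((t i' j : R) * (t i j : R))
  mixed_rel : ∀ ⦃i i' : Fin m⦄ ⦃j j' : Fin n⦄, i < i' → j ≠ j' →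
    (t i j : R) * (t i' j' : R) = (t i' j' : R) * (t i j : R)

/-- `white i j = true` means the square `(i,j)` is white.  The Cauchon
condition: for every black square, either every square above it or every
square to its left is also black. -/
def IsCauchon {m n : ℕ} (white : Fin m → Fin n → Bool) : Prop :=
  ∀ i j, white i j = false →
    (∀ i' : Fin m, i' < i → white i' j = false) ∨
    (∀ j' : Fin n, j' < j → white i j' = false)

/-- Vertices of the Cauchon graph: white squares, row vertices `r_i`,
column vertices `c_j`. -/
inductive CVertex (m n : ℕ) where
  | sq : Fin m → Fin n → CVertex m n
  | row : Fin m → CVertex m n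
  | col : Fin n → CVertex m n
deriving DecidableEq

/-- Directed edges of the Cauchon graph. -/
inductive CEdge {m n : ℕ} (white : Fin m → Fin n → Bool) :
    CVertex m n → CVertex m n → Prop where
  | fromRow (i : Fin m) (k : Fin n) :
      white i k = true → (∀ k' : Fin n, k < k' → white i k' = false) →
      CEdge white (.row i) (.sq i k)
  | toCol (i : Fin m) (j : Fin n) :
      white i j = true → (∀ i' : Fin m, i < i' → white i' j = false) →
      CEdge white (.sq i j) (.col j)
  | horiz (i : Fin m) (k j : Fin n) :
      j < k → white i k = true → white i j = true →
      (∀ j' : Fin n, j < j' → j' < k → white i j' = false) →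
      CEdge white (.sq i k) (.sq i j)
  | vert (i i' : Fin m) (j : Fin n) :
      i < i' → white i j = true → white i' j = true →
      (∀ l : Fin m, i < l → l < i' → white l j = false) →
      CEdge white (.sq i j) (.sq i' j)

/-- The weight of an edge of the Cauchon graph (1 on non-edges). -/
def wt {R : Type u} {m n : ℕ} [Ring R] (D : QMData R m n) :
    CVertex m n → CVertex m n → R
  | .row i, .sq i' k => if i = i' then (D.t i' k : R) else 1
  | .sq i k, .sq i' j =>
      if i = i' ∧ j < k then (↑((D.t i k)⁻¹) * ↑(D.t i j) : R) else 1
  | _, _ => 1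

/-- A pair of vertices spans a horizontal edge (edges from `r_i` are
horizontal; edges between squares are horizontal iff the rows agree). -/
def Horiz {m n : ℕ} : CVertex m n → CVertex m n → Prop
  | .row _, _ => True
  | .sq i _, .sq i' _ => i = i'
  | _, _ => False

/-- `l` is (the list of vertices of) a directed path from `u` to `v`. -/
def IsPathFrom {m n : ℕ} (white : Fin m → Fin n → Bool) (u v : CVertex m n)
    (l : List (CVertex m n)) : Prop :=
  l.Chain' (CEdge white) ∧ l.head? = some u ∧ l.getLast? = some v

/-- The list of (endpoint pairs of the) edges of a path. -/
def steps {m n : ℕ} (l : List (CVertex m n)) : List (CVertex m n × CVertex m n) :=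
  l.zip l.tail

/-- The weight of a path: the ordered product of its edge weights. -/
def pathWeight {R : Type u} {m n : ℕ} [Ring R] (D : QMData R m n)
    (l : List (CVertex m n)) : R :=
  ((steps l).map fun p => wt D p.1 p.2).prod

/-- The number of inversions (length) of a permutation of `Fin k`. -/
def invCount {k : ℕ} (σ : Equiv.Perm (Fin k)) : ℕ :=
  ((Finset.univ : Finset (Fin k × Fin k)).filter fun p => p.1 < p.2 ∧ σ p.2 < σ p.1).card

/-- The quantum determinant of a `k × k` matrix over a (noncommutative) ring. -/
def qdet {R : Type u} [Ring R] {k : ℕ} (q : Rˣ) (N : Matrix (Fin k) (Fin k) R) : R :=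
  ∑ σ : Equiv.Perm (Fin k),
    (-(q : R)) ^ invCount σ * ((List.finRange k).map fun i => N i (σ i)).prod

/-- The path matrix: entry `(i,j)` is the sum of the weights of all directed
paths from `r_i` to `c_j` (zero when there are none). -/
noncomputable def pathMatrix {R : Type u} {m n : ℕ} [Ring R] (D : QMData R m n)
    (white : Fin m → Fin n → Bool) : Matrix (Fin m) (Fin n) R :=
  Matrix.of fun i j =>
    ∑ᶠ p : {l : List (CVertex m n) // IsPathFrom white (.row i) (.col j) l},
      pathWeight D p.1

/-- An `(R_I, C_J)`-path system: paths `P ℓ : r_{i_ℓ} ⇒ c_{j_{σ ℓ}}`. -/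
structure PathSys {m n : ℕ} (white : Fin m → Fin n → Bool) {k : ℕ}
    (ι : Fin k → Fin m) (κ : Fin k → Fin n) where
  σ : Equiv.Perm (Fin k)
  P : Fin k → List (CVertex m n)
  isPath : ∀ l : Fin k, IsPathFrom white (.row (ι l)) (.col (κ (σ l))) (P l)

/-- A path system is vertex-disjoint if no two of its paths share a vertex. -/
def PathSys.VertexDisjoint {m n : ℕ} {white : Fin m → Fin n → Bool} {k : ℕ}
    {ι : Fin k → Fin m} {κ : Fin k → Fin n} (S : PathSys white ι κ) : Prop :=
  ∀ a b : Fin k, a ≠ b → ∀ x : CVertex m n, x ∈ S.P a → x ∈ S.P b → False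

/-- The weight of a path system: the ordered product `w(P₁)⋯w(P_k)`. -/
def PathSys.weight {R : Type u} {m n : ℕ} [Ring R] (D : QMData R m n)
    {white : Fin m → Fin n → Bool} {k : ℕ} {ι : Fin k → Fin m} {κ : Fin k → Fin n}
    (S : PathSys white ι κ) : R :=
  ((List.finRange k).map fun l => pathWeight D (S.P l)).prod

/-- The `q`-sign of a path system: `(-q) ^ ℓ(σ_P)`. -/
def PathSys.sgnq {R : Type u} {m n : ℕ} [Ring R] (D : QMData R m n)
    {white : Fin m → Fin n → Bool} {k : ℕ} {ι : Fin k → Fin m} {κ : Fin k → Fin n}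
    (S : PathSys white ι κ) : R :=
  (-(D.q : R)) ^ invCount S.σ


/-- Launois' algorithm: `launoisStep D white p` is the matrix `T^{(s,t)}` where
`(s,t)` is the `p`-th step in the lexicographic order (0-indexed: `s = p / n`,
`t = p % n`); step `0` is the initial matrix `T^{(1,1)}`. -/
def launoisStep {R : Type u} [Ring R] {m n : ℕ} (D : QMData R m n)
    (white : Fin m → Fin n → Bool) : ℕ → Matrix (Fin m) (Fin n) R
  | 0 => Matrix.of fun i j => if white i j then (D.t i j : R) else 0
  | p + 1 =>
    if h : (p + 1) / n < m ∧ (p + 1) % n < n then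
      let s : Fin m := ⟨(p + 1) / n, h.1⟩
      let t : Fin n := ⟨(p + 1) % n, h.2⟩
      if white s t then
        Matrix.of fun i j =>
          if (i : ℕ) < (s : ℕ) ∧ (j : ℕ) < (t : ℕ) then
            launoisStep D white p i j +
              launoisStep D white p i t * ↑((D.t s t)⁻¹) * launoisStep D white p s j
          else launoisStep D white p i j
      else launoisStep D white p
    else launoisStep D white p

/-- Algorithm state in row `s` once the columns before `c` have been processed. -/
def rowState {R : Type u} [Ring R] {m n : ℕ} (D : QMData R m n)
    (white : Fin m → Fin n → Bool) (s c : ℕ) : Matrix (Fin m) (Fin n) R :=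
  launoisStep D white (s * n + c - 1)

section RowState

variable {R : Type u} [Ring R] {m n : ℕ} (D : QMData R m n) (white : Fin m → Fin n → Bool)

theorem rowState_end (s : ℕ) : rowState D white s n = rowState D white (s + 1) 0 := by
  simp [rowState, Nat.succ_mul]

theorem rowState_succ (s : Fin m) (c : Fin n) (i : Fin m) (j : Fin n) :
    rowState D white s (c + 1) i j = rowState D white s c i j +
      if i < s ∧ j < c ∧ white s c = true then
        rowState D white s c i c * ↑((D.t s c)⁻¹) * rowState D white s c s j else 0 := by
  have hn : 0 < n := c.pos
  unfold rowState
  rcases Nat.eq_zero_or_pos ((s : ℕ) * n + c) with h0 | h0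
  · have hs : (s : ℕ) = 0 := by
      rcases Nat.eq_zero_or_pos (s : ℕ) with h | h
      · exact h
      · have := Nat.mul_pos h hn
        omega
    have : ¬ i < s := by rw [Fin.lt_def]; omega
    simp only [this, false_and, if_false, add_zero]
    rw [show (s : ℕ) * n + (c + 1) - 1 = s * n + c - 1 by omega]
  · obtain ⟨p, hp⟩ := Nat.exists_eq_add_of_lt h0
    have e1 : (s : ℕ) * n + (c + 1) - 1 = p + 1 := by omega
    have e2 : (s : ℕ) * n + c - 1 = p := by omega
    have hdiv : (p + 1) / n = s := by
      rw [show p + 1 = (c : ℕ) + n * s by rw [mul_comm]; omega, Nat.add_mul_div_left _ _ hn,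
        Nat.div_eq_of_lt c.2, zero_add]
    have hmod : (p + 1) % n = c := by
      rw [show p + 1 = (c : ℕ) + n * s by rw [mul_comm]; omega, Nat.add_mul_mod_self_left,
        Nat.mod_eq_of_lt c.2]
    rw [e1, e2, launoisStep, dif_pos ⟨hdiv ▸ s.2, hmod ▸ c.2⟩]
    have es : (⟨(p + 1) / n, hdiv ▸ s.2⟩ : Fin m) = s := Fin.ext hdiv
    have ec : (⟨(p + 1) % n, hmod ▸ c.2⟩ : Fin n) = c := Fin.ext hmod
    simp only [es, ec]
    by_cases hw : white s c = true
    · simp only [hw, if_true, Matrix.of_apply, and_true, Fin.lt_def, hdiv, hmod]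
      split_ifs <;> simp
    · simp [hw]

theorem rowState_of_le (s i : Fin m) (h : s ≤ i) (j : Fin n) {c : ℕ} (hc : c ≤ n) :
    rowState D white s c i j = rowState D white s 0 i j := by
  induction c with
  | zero => rfl
  | succ c ih =>
    rw [rowState_succ D white s ⟨c, hc⟩ i j, if_neg (fun h' => absurd h'.1 (not_lt.2 h)), add_zero]
    exact ih (by omega)

theorem rowState_zero_of_le (s : ℕ) (i : Fin m) (h : s ≤ i + 1) (j : Fin n) :
    rowState D white s 0 i j = if white i j then (D.t i j : R) else 0 := by
  induction s with
  | zero => simp [rowState, launoisStep]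
  | succ s ih =>
    rw [← rowState_end, rowState_of_le D white ⟨s, by omega⟩ i (Fin.le_def.2 (by simp; omega)) j le_rfl]
    exact ih (by omega)

theorem rowState_of_black (s i : Fin m) (j : Fin n) {c : ℕ} (hc : c ≤ n)
    (hb : ∀ c' : Fin n, j < c' → (c' : ℕ) < c → white s c' = false) :
    rowState D white s c i j = rowState D white s 0 i j := by
  induction c with
  | zero => rfl
  | succ c ih =>
    rw [rowState_succ D white s ⟨c, hc⟩ i j, if_neg, add_zero]
    · exact ih (by omega) fun c' h1 h2 => hb c' h1 (by omega)
    · rintro ⟨-, h1, h2⟩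
      rw [hb _ h1 (by simp)] at h2
      exact absurd h2 (by simp)

theorem rowState_succ_eq (s : Fin m) (c : Fin n) (i : Fin m) (his : i < s) (j : Fin n) :
    rowState D white s (c + 1) i j = rowState D white s c i j +
      if j < c ∧ white s c = true then
        rowState D white s 0 i c * ↑((D.t s c)⁻¹) * (if white s j then (D.t s j : R) else 0)
      else 0 := by
  rw [rowState_succ, rowState_of_black D white s i c c.2.le
      (fun c' h1 h2 => absurd h1 (not_lt.2 (Fin.le_def.2 h2.le))),
    rowState_of_le D white s s le_rfl j c.2.le, rowState_zero_of_le D white s s (by omega) j]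
  simp [his]

theorem rowState_row_succ_of_black (s i : Fin m) (his : i < s) (j : Fin n)
    (hb : white s j = false) :
    rowState D white (s + 1) 0 i j = rowState D white s 0 i j := by
  rw [← rowState_end]
  suffices ∀ c ≤ n, rowState D white s c i j = rowState D white s 0 i j from this n le_rfl
  intro c hc
  induction c with
  | zero => rfl
  | succ c ih =>
    rw [rowState_succ_eq D white s ⟨c, hc⟩ i his j, ih (by omega)]
    simp [hb]

theorem rowState_row_succ_of_rightmost (s i : Fin m) (j : Fin n)
    (hb : ∀ c' : Fin n, j < c' → white s c' = false) :
    rowState D white (s + 1) 0 i j = rowState D white s 0 i j := by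
  rw [← rowState_end]
  exact rowState_of_black D white s i j le_rfl fun c' h _ => hb c' h

theorem rowState_row_succ_of_next (s i : Fin m) (his : i < s) (j k : Fin n) (hjk : j < k)
    (hj : white s j = true) (hk : white s k = true)
    (hb : ∀ c' : Fin n, j < c' → c' < k → white s c' = false) :
    rowState D white (s + 1) 0 i j = rowState D white s 0 i j +
      rowState D white (s + 1) 0 i k * (↑((D.t s k)⁻¹) * ↑(D.t s j)) := by
  rw [← rowState_end]
  suffices ∀ c, (k : ℕ) + 1 ≤ c → c ≤ n → rowState D white s c i j = rowState D white s 0 i j +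
      rowState D white s c i k * (↑((D.t s k)⁻¹) * ↑(D.t s j)) from this n k.2 le_rfl
  intro c hkc
  induction c, hkc using Nat.le_induction with
  | base =>
    intro _
    rw [rowState_succ_eq D white s k i his j, rowState_of_black D white s i j k.2.le
      (fun c' h1 h2 => hb c' h1 h2), rowState_of_black D white s i k k.2
      (fun c' h1 h2 => absurd h1 (by rw [Fin.lt_def]; omega))]
    simp [hjk, hk, hj, mul_assoc]
  | succ c hc ih =>
    intro hcn
    have h1 : k < ⟨c, hcn⟩ := Fin.lt_def.2 hc
    have h2 : j < ⟨c, hcn⟩ := hjk.trans h1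
    rw [rowState_succ_eq D white s ⟨c, hcn⟩ i his j, rowState_succ_eq D white s ⟨c, hcn⟩ i his k]
    simp only [h1, h2, hj, hk, true_and, if_true]
    rw [ih (by omega)]
    split_ifs <;> simp [add_mul, mul_assoc, add_assoc]

/-- Passing over a block of rows that are black in column `j`. -/
theorem rowState_zero_eq_of_black (i : Fin m) (j : Fin n) {s s' : ℕ} (h : s ≤ s') (hs' : s' ≤ m)
    (his : (i : ℕ) < s)
    (hb : ∀ l : Fin m, s ≤ l → (l : ℕ) < s' → white l j = false) :
    rowState D white s' 0 i j = rowState D white s 0 i j := by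
  induction s', h using Nat.le_induction with
  | base => rfl
  | succ s' h ih =>
    rw [rowState_row_succ_of_black D white ⟨s', hs'⟩ i (Fin.lt_def.2 (by simp; omega)) j
      (hb _ h (by simp))]
    exact ih (by omega) fun l h1 h2 => hb l h1 (by omega)

end RowState

/-- The directed paths from `u` to `v` in the Cauchon graph. -/
def pathsBetween {m n : ℕ} (white : Fin m → Fin n → Bool) (u v : CVertex m n) :
    Set (List (CVertex m n)) :=
  {l | IsPathFrom white u v l}

/-- The total weight of the directed paths from `u` to `v`. -/
noncomputable def pathSum {R : Type u} {m n : ℕ} [Ring R] (D : QMData R m n)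
    (white : Fin m → Fin n → Bool) (u v : CVertex m n) : R :=
  ∑ᶠ l ∈ pathsBetween white u v, pathWeight D l

/-- A height function which increases along every edge of the Cauchon graph. -/
def CVertex.height {m n : ℕ} : CVertex m n → ℕ
  | .row _ => 0
  | .sq s t => (s + 1) * n - t
  | .col _ => m * n + 1

section Paths

variable {m n : ℕ} {white : Fin m → Fin n → Bool}

theorem CEdge.height_lt {u v : CVertex m n} (h : CEdge white u v) : u.height < v.height := by
  have aux : ∀ s : Fin m, n ≤ (s + 1) * n := fun s => Nat.le_mul_of_pos_left _ (by omega)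
  cases h with
  | fromRow i k => have := aux i; simp only [CVertex.height]; omega
  | toCol i j =>
    have : ((i : ℕ) + 1) * n ≤ m * n := Nat.mul_le_mul_right _ i.2
    simp only [CVertex.height]; omega
  | horiz i k j hjk => have := aux i; simp only [CVertex.height]; omega
  | vert i i' j hii =>
    have h1 : ((i : ℕ) + 1) * n ≤ i' * n := Nat.mul_le_mul_right _ hii
    have h2 := Nat.succ_mul (i' : ℕ) n
    simp only [CVertex.height, Nat.succ_eq_add_one] at *; omega

theorem isPathFrom_iff_isChain {u v : CVertex m n} {l : List (CVertex m n)} :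
    IsPathFrom white u v l ↔
      l.IsChain (CEdge white) ∧ l.head? = some u ∧ l.getLast? = some v := Iff.rfl

theorem isPathFrom_iff_snoc {u v : CVertex m n} {l : List (CVertex m n)} :
    IsPathFrom white u v l ↔
      (u = v ∧ l = [v]) ∨ ∃ w l', CEdge white w v ∧ IsPathFrom white u w l' ∧ l = l' ++ [v] := by
  simp only [isPathFrom_iff_isChain]
  rcases List.eq_nil_or_concat l with rfl | ⟨l, x, rfl⟩
  · simp
  · rcases List.eq_nil_or_concat l with rfl | ⟨l, y, rfl⟩
    · simp only [List.concat_eq_append, List.nil_append]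
      constructor
      · rintro ⟨-, h1, h2⟩
        simp at h1 h2
        subst h1 h2
        simp
      · rintro (⟨rfl, h⟩ | ⟨w, l', -, ⟨-, h, -⟩, h'⟩)
        · simpa using h
        · have : l' = [] := by
            have := congrArg List.length h'
            simpa using this
          simp [this] at h
    · simp only [List.concat_eq_append, List.isChain_append, List.getLast?_append,
        List.head?_append]
      constructor
      · rintro ⟨⟨h1, -, h2⟩, h3, h4⟩
        simp at h2 h3 h4
        subst h4
        exact Or.inr ⟨y, l ++ [y], h2, ⟨by simpa [List.isChain_append] using h1,
          by simpa using h3, by simp⟩, rfl⟩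
      · rintro (⟨rfl, h⟩ | ⟨w, l', hw, ⟨h1, h2, h3⟩, h'⟩)
        · simpa using congrArg List.length h
        · obtain ⟨rfl, h''⟩ := List.append_inj' h' rfl
          simp at h'' h3
          subst h'' h3
          refine ⟨⟨by simpa [List.isChain_append] using h1, by simp, by simpa using hw⟩,
            by simpa using h2, by simp⟩

theorem pathsBetween_eq {u v : CVertex m n} (h : u ≠ v) :
    pathsBetween white u v =
      ⋃ w ∈ {w | CEdge white w v}, (· ++ [v]) '' pathsBetween white u w := by
  ext l
  simp only [pathsBetween, Set.mem_ofPred_eq, Set.mem_iUnion, Set.mem_image]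
  rw [isPathFrom_iff_snoc]
  simp only [h, false_and, false_or]
  constructor
  · rintro ⟨w, l', h1, h2, rfl⟩
    exact ⟨w, h1, l', h2, rfl⟩
  · rintro ⟨w, h1, l', h2, rfl⟩
    exact ⟨w, l', h1, h2, rfl⟩

instance : Finite (CVertex m n) :=
  Finite.of_surjective (α := (Fin m × Fin n) ⊕ Fin m ⊕ Fin n)
    (Sum.elim (fun p => .sq p.1 p.2) (Sum.elim .row .col)) (by
      rintro (⟨s, t⟩ | i | j)
      · exact ⟨.inl (s, t), rfl⟩
      · exact ⟨.inr (.inl i), rfl⟩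
      · exact ⟨.inr (.inr j), rfl⟩)

theorem finite_pathsBetween (u v : CVertex m n) : (pathsBetween white u v).Finite := by
  induction hN : v.height using Nat.strong_induction_on generalizing v with
  | _ N ih =>
    subst hN
    refine ((Set.finite_singleton [v]).union (Set.Finite.biUnion (Set.toFinite {w | CEdge white w v})
      fun w hw => (ih _ (CEdge.height_lt hw) w rfl).image (· ++ [v]))).subset ?_
    intro l hl
    rcases isPathFrom_iff_snoc.1 hl with ⟨-, h⟩ | ⟨w, l', h1, h2, rfl⟩
    · exact Or.inl h
    · exact Or.inr (Set.mem_biUnion h1 ⟨l', h2, rfl⟩)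

theorem IsPathFrom.height_le {u v : CVertex m n} {l : List (CVertex m n)}
    (h : IsPathFrom white u v l) {x : CVertex m n} (hx : x ∈ l) : x.height ≤ v.height := by
  induction hN : v.height using Nat.strong_induction_on generalizing v l with
  | _ N ih =>
    subst hN
    rcases isPathFrom_iff_snoc.1 h with ⟨-, rfl⟩ | ⟨w, l', h1, h2, rfl⟩
    · rw [List.mem_singleton.1 hx]
    · rcases List.mem_append.1 hx with hx | hx
      · exact (ih _ h1.height_lt h2 hx rfl).trans h1.height_lt.le
      · rw [List.mem_singleton.1 hx]

theorem not_cEdge_row (w : CVertex m n) (i : Fin m) : ¬ CEdge white w (.row i) := nofun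

theorem isPathFrom_row_iff {u : CVertex m n} {i : Fin m} {l : List (CVertex m n)} :
    IsPathFrom white u (.row i) l ↔ u = .row i ∧ l = [.row i] := by
  rw [isPathFrom_iff_snoc]
  simp [not_cEdge_row]

/-- Sets of paths ending in distinct vertices are disjoint. -/
theorem pairwiseDisjoint_snoc (u v : CVertex m n) (I : Set (CVertex m n)) :
    I.PairwiseDisjoint fun w => (· ++ [v]) '' pathsBetween white u w := by
  intro w _ w' _ hne
  rw [Function.onFun, Set.disjoint_left]
  rintro _ ⟨l, hl, rfl⟩ ⟨l', hl', h⟩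
  have h' : l' = l := by simpa using h
  subst h'
  have := hl.2.2.symm.trans hl'.2.2
  exact hne (by simpa using this)

variable {R : Type u} [Ring R] (D : QMData R m n)

theorem steps_append (l l' : List (CVertex m n)) (x : CVertex m n) :
    steps (l ++ x :: l') = steps (l ++ [x]) ++ steps (x :: l') := by
  induction l with
  | nil => simp [steps]
  | cons a l ih =>
    cases l with
    | nil => simp [steps]
    | cons b l => simpa [steps] using ih

theorem pathWeight_append (l l' : List (CVertex m n)) (x : CVertex m n) :
    pathWeight D (l ++ x :: l') = pathWeight D (l ++ [x]) * pathWeight D (x :: l') := by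
  unfold pathWeight
  rw [steps_append]
  simp

theorem pathWeight_snoc {u w : CVertex m n} (v : CVertex m n) {l : List (CVertex m n)}
    (h : IsPathFrom white u w l) : pathWeight D (l ++ [v]) = pathWeight D l * wt D w v := by
  obtain ⟨-, -, h⟩ := h
  obtain ⟨l, rfl⟩ := List.getLast?_eq_some_iff.1 h
  rw [List.append_assoc, List.singleton_append, pathWeight_append]
  simp [pathWeight, steps]

/-- The paths from `u` to `v` whose last edge starts in `I` have total weight obtained by
summing over the start of that last edge. -/
theorem finsum_snoc (u v : CVertex m n) (I : Set (CVertex m n)) :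
    ∑ᶠ l ∈ ⋃ w ∈ I, (· ++ [v]) '' pathsBetween white u w, pathWeight D l =
      ∑ᶠ w ∈ I, pathSum D white u w * wt D w v := by
  rw [finsum_mem_biUnion (pairwiseDisjoint_snoc u v I) (Set.toFinite _)
    fun w _ => (finite_pathsBetween u w).image _]
  refine finsum_mem_congr rfl fun w _ => ?_
  rw [finsum_mem_image (List.append_left_injective [v]).injOn, pathSum,
    finsum_mem_mul' _ _ (finite_pathsBetween u w)]
  exact finsum_mem_congr rfl fun l hl => pathWeight_snoc D v hl

theorem pathSum_row (u : CVertex m n) (i : Fin m) [Decidable (u = .row i)] :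
    pathSum D white u (.row i) = if u = .row i then 1 else 0 := by
  unfold pathSum
  split_ifs with h
  · have : pathsBetween white u (.row i) = {[.row i]} := by
      ext l
      simp [pathsBetween, isPathFrom_row_iff, h]
    rw [this, finsum_mem_singleton]
    simp [pathWeight, steps]
  · have : pathsBetween white u (.row i) = ∅ := by
      ext l
      simp [pathsBetween, isPathFrom_row_iff, h]
    rw [this, finsum_mem_empty]

/-- The starts of the vertical edges into `v`. -/
def vertPred (white : Fin m → Fin n → Bool) (v : CVertex m n) : Set (CVertex m n) :=
  {w | CEdge white w v ∧ ¬ Horiz w v}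

/-- The starts of the horizontal edges into `v`. -/
def horizPred (white : Fin m → Fin n → Bool) (v : CVertex m n) : Set (CVertex m n) :=
  {w | CEdge white w v ∧ Horiz w v}

theorem pathSum_eq {u v : CVertex m n} (h : u ≠ v) :
    pathSum D white u v = ∑ᶠ w ∈ vertPred white v, pathSum D white u w * wt D w v +
      ∑ᶠ w ∈ horizPred white v, pathSum D white u w * wt D w v := by
  rw [pathSum, pathsBetween_eq h, finsum_snoc, ← finsum_mem_union _ (Set.toFinite _)
    (Set.toFinite _)]
  · refine finsum_mem_congr ?_ fun _ _ => rfl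
    ext w
    by_cases hw : Horiz w v <;> simp [vertPred, horizPred, hw]
  · rw [Set.disjoint_left]
    exact fun w h1 h2 => h1.2 h2.2

theorem horizPred_sq_of_rightmost {s : Fin m} {t : Fin n} (hw : white s t = true)
    (hb : ∀ c : Fin n, t < c → white s c = false) :
    horizPred white (.sq s t) = {.row s} := by
  ext w
  simp only [horizPred, Set.mem_ofPred_eq, Set.mem_singleton_iff]
  constructor
  · rintro ⟨h1, h2⟩
    cases h1 with
    | fromRow => rfl
    | horiz _ k _ h3 h4 => simp [hb k h3] at h4
    | vert i _ _ h3 => exact absurd h2 h3.ne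
  · rintro rfl
    exact ⟨.fromRow s t hw hb, trivial⟩

theorem horizPred_sq_of_next {s : Fin m} {t k : Fin n} (htk : t < k) (hw : white s t = true)
    (hk : white s k = true) (hb : ∀ c : Fin n, t < c → c < k → white s c = false) :
    horizPred white (.sq s t) = {.sq s k} := by
  ext w
  simp only [horizPred, Set.mem_ofPred_eq, Set.mem_singleton_iff]
  constructor
  · rintro ⟨h1, h2⟩
    cases h1 with
    | fromRow _ _ h3 h4 => simp [h4 k htk] at hk
    | horiz _ k' _ h3 h4 h5 h6 =>
      rcases lt_trichotomy k k' with h | rfl | h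
      · simp [h6 k htk h] at hk
      · rfl
      · simp [hb k' h3 h] at h4
    | vert i _ _ h3 => exact absurd h2 h3.ne
  · rintro rfl
    exact ⟨.horiz s k t htk hk hw hb, rfl⟩

theorem vertPred_sq_of_topmost {s : Fin m} {t : Fin n}
    (hb : ∀ l : Fin m, l < s → white l t = false) :
    vertPred white (.sq s t) = ∅ := by
  ext w
  simp only [vertPred, Set.mem_ofPred_eq, Set.mem_empty_iff_false, iff_false]
  rintro ⟨h1, h2⟩
  cases h1 with
  | fromRow => exact h2 trivial
  | horiz => exact h2 rfl
  | vert i _ _ h3 h4 => simp [hb i h3] at h4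

theorem vertPred_sq_of_prev {s r : Fin m} {t : Fin n} (hrs : r < s) (hw : white s t = true)
    (hr : white r t = true) (hb : ∀ l : Fin m, r < l → l < s → white l t = false) :
    vertPred white (.sq s t) = {.sq r t} := by
  ext w
  simp only [vertPred, Set.mem_ofPred_eq, Set.mem_singleton_iff]
  constructor
  · rintro ⟨h1, h2⟩
    cases h1 with
    | fromRow => exact absurd trivial h2
    | horiz => exact absurd rfl h2
    | vert i _ _ h3 h4 h5 h6 =>
      rcases lt_trichotomy r i with h | rfl | h
      · simp [hb i h h3] at h4
      · rfl
      · simp [h6 r h hrs] at hr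
  · rintro rfl
    exact ⟨.vert r s t hrs hr hw hb, hrs.ne⟩

end Paths

/-- Either no index in a given range satisfies `p`, or there is a largest one below `a`. -/
theorem Fin.exists_greatest_below {n : ℕ} (p : Fin n → Bool) (a : Fin n) :
    (∀ c, c < a → p c = false) ∨
      ∃ b, b < a ∧ p b = true ∧ ∀ c, b < c → c < a → p c = false := by
  by_cases h : ∃ b, b < a ∧ p b = true
  · obtain ⟨b, hb⟩ := (Set.toFinite {b | b < a ∧ p b = true}).exists_maximal h
    refine Or.inr ⟨b, hb.1.1, hb.1.2, fun c h1 h2 => ?_⟩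
    by_contra h3
    exact absurd (hb.2 ⟨h2, by simpa using h3⟩ h1.le) (not_le.2 h1)
  · push Not at h
    exact Or.inl fun c hc => by simpa using h c hc

/-- Either no index above `a` satisfies `p`, or there is a smallest one. -/
theorem Fin.exists_least_above {n : ℕ} (p : Fin n → Bool) (a : Fin n) :
    (∀ c, a < c → p c = false) ∨
      ∃ b, a < b ∧ p b = true ∧ ∀ c, a < c → c < b → p c = false := by
  by_cases h : ∃ b, a < b ∧ p b = true
  · obtain ⟨b, hb⟩ := (Set.toFinite {b | a < b ∧ p b = true}).exists_minimal h
    refine Or.inr ⟨b, hb.1.1, hb.1.2, fun c h1 h2 => ?_⟩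
    by_contra h3
    exact absurd (hb.2 ⟨h1, by simpa using h3⟩ h2.le) (not_le.2 h2)
  · push Not at h
    exact Or.inl fun c hc => by simpa using h c hc

section PathSum

variable {R : Type u} [Ring R] {m n : ℕ} (D : QMData R m n) (white : Fin m → Fin n → Bool)

theorem finsum_vertPred_sq (i s : Fin m) (t : Fin n) (hw : white s t = true)
    (ih : ∀ r < s, white r t = true →
      pathSum D white (.row i) (.sq r t) = if i ≤ r then rowState D white (r + 1) 0 i t else 0) :
    ∑ᶠ w ∈ vertPred white (.sq s t), pathSum D white (.row i) w * wt D w (.sq s t) =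
      if i < s then rowState D white s 0 i t else 0 := by
  have hblack : ∀ his : i < s, (∀ l : Fin m, i ≤ l → l < s → white l t = false) →
      rowState D white s 0 i t = 0 := fun his hb => by
    rw [rowState_zero_eq_of_black D white i t (Nat.succ_le_of_lt his) s.2.le (Nat.lt_succ_self _)
      fun l h1 h2 => hb l (Fin.le_def.2 (Nat.le_of_succ_le h1)) h2,
      rowState_zero_of_le D white _ i le_rfl, hb i le_rfl his]
    simp
  rcases Fin.exists_greatest_below (fun l => white l t) s with hb | ⟨r, hrs, hr, hb⟩
  · rw [vertPred_sq_of_topmost hb, finsum_mem_empty]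
    split_ifs with his
    · exact (hblack his fun l _ h => hb l h).symm
    · rfl
  · rw [vertPred_sq_of_prev hrs hw hr hb, finsum_mem_singleton, ih r hrs hr]
    have : wt D (.sq r t) (.sq s t) = 1 := by simp [wt]
    rw [this, mul_one]
    by_cases hir : i ≤ r
    · rw [if_pos hir, if_pos (hir.trans_lt hrs)]
      exact (rowState_zero_eq_of_black D white i t (Nat.succ_le_of_lt hrs) s.2.le
        (Nat.lt_succ_of_le hir) fun l h1 h2 => hb l h1 h2).symm
    · rw [if_neg hir]
      split_ifs with his
      · exact (hblack his fun l h1 h2 => hb l ((not_le.1 hir).trans_le h1) h2).symm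
      · rfl

/-- The entries of the matrices of the algorithm count weighted paths to white squares. -/
theorem pathSum_row_sq (i s : Fin m) (t : Fin n) (hw : white s t = true) :
    pathSum D white (.row i) (.sq s t) =
      if i ≤ s then rowState D white (s + 1) 0 i t else 0 := by
  induction hN : (CVertex.sq s t).height using Nat.strong_induction_on generalizing s t with
  | _ N ih =>
    subst hN
    rw [pathSum_eq D (by simp), finsum_vertPred_sq D white i s t hw fun r hr hr' => ?_]
    · rcases Fin.exists_least_above (white s) t with hb | ⟨k, htk, hk, hb⟩
      · rw [horizPred_sq_of_rightmost hw hb, finsum_mem_singleton, pathSum_row]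
        have hwt : wt D (.row s) (.sq s t) = D.t s t := by simp [wt]
        rw [hwt]
        rcases lt_trichotomy i s with h | rfl | h
        · simp [h, h.le, h.ne, rowState_row_succ_of_rightmost D white s i t hb]
        · simp [rowState_zero_of_le D white (i + 1) i le_rfl, hw]
        · simp [h.not_ge, h.not_gt, h.ne']
      · rw [horizPred_sq_of_next htk hw hk hb, finsum_mem_singleton,
          ih _ (CEdge.horiz s k t htk hk hw hb).height_lt s k hk rfl]
        have hwt : wt D (.sq s k) (.sq s t) = ↑((D.t s k)⁻¹) * ↑(D.t s t) := by simp [wt, htk]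
        rw [hwt]
        rcases lt_trichotomy i s with h | rfl | h
        · simp only [h, h.le, if_true]
          exact (rowState_row_succ_of_next D white s i h t k htk hw hk hb).symm
        · simp [rowState_zero_of_le D white (i + 1) i le_rfl, hw, hk]
        · simp [h.not_ge, h.not_gt]
    · refine ih _ ?_ r t hr' rfl
      have h1 : ((r : ℕ) + 1) * n ≤ s * n := Nat.mul_le_mul_right _ hr
      have h2 := Nat.succ_mul (s : ℕ) n
      have := t.2
      simp only [CVertex.height, Nat.succ_eq_add_one] at *
      omega

end PathSum

section LastRow

variable {m n : ℕ} {white : Fin m → Fin n → Bool}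

theorem IsPathFrom.start_mem {u v : CVertex m n} {l : List (CVertex m n)}
    (h : IsPathFrom white u v l) : u ∈ l :=
  List.mem_of_head? h.2.1

theorem IsPathFrom.end_mem {u v : CVertex m n} {l : List (CVertex m n)}
    (h : IsPathFrom white u v l) : v ∈ l :=
  List.mem_of_getLast? h.2.2

theorem IsPathFrom.append {u v w : CVertex m n} {l l' : List (CVertex m n)}
    (h : IsPathFrom white u v l) (h' : IsPathFrom white v w l') :
    IsPathFrom white u w (l ++ l'.tail) := by
  rw [isPathFrom_iff_isChain] at *
  obtain ⟨h1, h2, h3⟩ := h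
  obtain ⟨h1', h2', h3'⟩ := h'
  obtain ⟨K, rfl⟩ := List.head?_eq_some_iff.1 h2'
  rw [List.isChain_cons] at h1'
  refine ⟨List.isChain_append.2 ⟨h1, h1'.2, ?_⟩, by simp [h2], ?_⟩
  · intro x hx y hy
    rw [h3] at hx
    cases hx
    exact h1'.1 y hy
  · rw [List.tail_cons, List.getLast?_append, h3]
    rw [List.getLast?_cons] at h3'
    cases hK : K.getLast? <;> simpa [hK] using h3'

theorem pathWeight_append_tail {R : Type u} [Ring R] (D : QMData R m n) {u v w : CVertex m n}
    {l l' : List (CVertex m n)} (h : IsPathFrom white u v l) (h' : IsPathFrom white v w l') :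
    pathWeight D (l ++ l'.tail) = pathWeight D l * pathWeight D l' := by
  obtain ⟨l, rfl⟩ := List.getLast?_eq_some_iff.1 h.2.2
  obtain ⟨K, rfl⟩ := List.head?_eq_some_iff.1 h'.2.1
  rw [List.tail_cons, List.append_assoc, List.singleton_append, pathWeight_append]

/-- There is exactly one path along row `s` between two of its white squares. -/
theorem exists_unique_row_path {R : Type u} [Ring R] (D : QMData R m n) (s : Fin m) (k t : Fin n)
    (htk : t ≤ k) (hk : white s k = true) (ht : white s t = true) :
    ∃ K₀, (∀ K, (IsPathFrom white (.sq s k) (.sq s t) K ∧ ∀ v ∈ K, ∃ c, v = .sq s c) ↔ K = K₀) ∧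
      pathWeight D K₀ = ↑((D.t s k)⁻¹) * ↑(D.t s t) := by
  induction hN : (k : ℕ) - t using Nat.strong_induction_on generalizing t with
  | _ N ih =>
    subst hN
    rcases htk.eq_or_lt with rfl | htk
    · refine ⟨[.sq s t], fun K => ⟨fun ⟨h, _⟩ => ?_, ?_⟩, by simp [pathWeight, steps]⟩
      · rcases isPathFrom_iff_snoc.1 h with ⟨-, h⟩ | ⟨w, l', h1, h2, rfl⟩
        · exact h
        · exact absurd (h2.height_le h2.start_mem) (not_le.2 h1.height_lt)
      · rintro rfl
        exact ⟨isPathFrom_iff_snoc.2 (Or.inl ⟨rfl, rfl⟩), by simp⟩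
    · rcases Fin.exists_least_above (white s) t with hb | ⟨b, htb, hwb, hb⟩
      · simp [hb k htk] at hk
      · have hbk : b ≤ k := by
          by_contra hlt
          simp [hb k htk (not_le.1 hlt)] at hk
        obtain ⟨K₁, hK₁, hw⟩ := ih _ (by omega) b hbk hwb rfl
        have hpath := (hK₁ K₁).2 rfl
        refine ⟨K₁ ++ [.sq s t], fun K => ⟨fun ⟨h, hrow⟩ => ?_, ?_⟩, ?_⟩
        · rcases isPathFrom_iff_snoc.1 h with ⟨h, -⟩ | ⟨w, l', h1, h2, rfl⟩
          · simp [htk.ne'] at h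
          · have hrow' : ∀ v ∈ l', ∃ c, v = .sq s c := fun v hv => hrow v (by simp [hv])
            obtain ⟨c, rfl⟩ := hrow' w h2.end_mem
            have hmem : CVertex.sq s c ∈ horizPred white (.sq s t) := ⟨h1, rfl⟩
            rw [horizPred_sq_of_next htb ht hwb hb, Set.mem_singleton_iff] at hmem
            rw [hmem] at h2
            rw [(hK₁ l').1 ⟨h2, hrow'⟩]
        · rintro rfl
          refine ⟨isPathFrom_iff_snoc.2 (Or.inr ⟨_, _, .horiz s b t htb hwb ht hb, hpath.1, rfl⟩),
            fun v hv => ?_⟩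
          rcases List.mem_append.1 hv with hv | hv
          · exact hpath.2 v hv
          · exact ⟨t, List.mem_singleton.1 hv⟩
        · rw [pathWeight_snoc D _ hpath.1, hw]
          simp [wt, htb, mul_assoc]

/-- The paths from square `(s,k)` to `c_j` all of whose squares lie in row `s`. -/
def rowTails (white : Fin m → Fin n → Bool) (s : Fin m) (k j : Fin n) :
    Set (List (CVertex m n)) :=
  {K | IsPathFrom white (.sq s k) (.col j) K ∧
    ∀ v ∈ K, (∃ c, v = CVertex.sq s c) ∨ v = CVertex.col j}

theorem exists_of_mem_rowTails {s : Fin m} {k j : Fin n} {K : List (CVertex m n)}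
    (hK : K ∈ rowTails white s k j) :
    white s j = true ∧ ∃ K', IsPathFrom white (.sq s k) (.sq s j) K' ∧
      (∀ v ∈ K', ∃ c, v = .sq s c) ∧ K = K' ++ [.col j] := by
  obtain ⟨h, hrow⟩ := hK
  rcases isPathFrom_iff_snoc.1 h with ⟨h, -⟩ | ⟨w, l', h1, h2, rfl⟩
  · cases h
  · have hrow' : ∀ v ∈ l', ∃ c, v = .sq s c := fun v hv => by
      rcases hrow v (by simp [hv]) with h | rfl
      · exact h
      · exact absurd (h2.height_le hv) (not_le.2 h1.height_lt)
    obtain ⟨c, rfl⟩ := hrow' w h2.end_mem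
    cases h1 with
    | toCol _ _ h3 h4 => exact ⟨h3, l', h2, hrow', rfl⟩

theorem rowTails_of_black {s : Fin m} {k j : Fin n} (hj : white s j = false) :
    rowTails white s k j = ∅ := by
  refine Set.eq_empty_of_forall_notMem fun K hK => ?_
  simp [(exists_of_mem_rowTails hK).1] at hj

theorem rowTails_eq_singleton {R : Type u} [Ring R] (D : QMData R m n) {s : Fin m} {k j : Fin n}
    (hjk : j ≤ k) (hk : white s k = true) (hj : white s j = true)
    (hs : ∀ l, s < l → white l j = false) :
    ∃ K₀, rowTails white s k j = {K₀} ∧ pathWeight D K₀ = ↑((D.t s k)⁻¹) * ↑(D.t s j) := by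
  obtain ⟨K₁, hK₁, hw⟩ := exists_unique_row_path D s k j hjk hk hj
  have hpath := (hK₁ K₁).2 rfl
  refine ⟨K₁ ++ [.col j], Set.Subset.antisymm ?_ ?_, ?_⟩
  · intro K hK
    obtain ⟨-, K', h1, h2, rfl⟩ := exists_of_mem_rowTails hK
    rw [(hK₁ K').1 ⟨h1, h2⟩]
    rfl
  · rintro _ rfl
    refine ⟨isPathFrom_iff_snoc.2 (Or.inr ⟨_, _, .toCol s j hj hs, hpath.1, rfl⟩), fun v hv => ?_⟩
    rcases List.mem_append.1 hv with hv | hv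
    · exact Or.inl (hpath.2 v hv)
    · exact Or.inr (List.mem_singleton.1 hv)
  · rw [pathWeight_snoc D _ hpath.1, hw]
    simp [wt]

theorem CEdge.white_of_sq {w : CVertex m n} {s : Fin m} {t : Fin n}
    (h : CEdge white w (.sq s t)) : white s t = true := by
  cases h <;> assumption

theorem exists_of_mem_vertPred {w : CVertex m n} {s : Fin m} {t : Fin n}
    (h : w ∈ vertPred white (.sq s t)) : ∃ r < s, w = .sq r t := by
  obtain ⟨h1, h2⟩ := h
  cases h1 with
  | fromRow => exact absurd trivial h2
  | horiz => exact absurd rfl h2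
  | vert r _ _ h3 => exact ⟨r, h3, rfl⟩

theorem mem_of_mem_steps {l : List (CVertex m n)} {a b : CVertex m n} (h : (a, b) ∈ steps l) :
    a ∈ l ∧ b ∈ l :=
  ⟨(List.of_mem_zip h).1, List.mem_of_mem_tail (List.of_mem_zip h).2⟩

/-- Decomposition of the paths which enter square `(s,k)` vertically and then follow row `s`. -/
theorem setOf_vertical_then_row_eq (i s : Fin m) (k j : Fin n) :
    {l : List (CVertex m n) | IsPathFrom white (.row i) (.col j) l ∧
        (∃ Q K : List (CVertex m n), l = Q ++ K.tail ∧
          IsPathFrom white (.row i) (.sq s k) Q ∧ IsPathFrom white (.sq s k) (.col j) K ∧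
          ∀ v ∈ K, (∃ c : Fin n, v = CVertex.sq s c) ∨ v = CVertex.col j) ∧
        ∃ r : Fin m, r < s ∧ (CVertex.sq r k, CVertex.sq s k) ∈ steps l} =
      ⋃ K ∈ rowTails white s k j, (· ++ K.tail) ''
        ⋃ w ∈ vertPred white (.sq s k), (· ++ [.sq s k]) '' pathsBetween white (.row i) w := by
  ext l
  simp only [Set.mem_ofPred_eq, Set.mem_iUnion, Set.mem_image, exists_prop]
  constructor
  · rintro ⟨-, ⟨Q, K, rfl, hQ, hK, hrow⟩, r, hr, hstep⟩
    refine ⟨K, ⟨hK, hrow⟩, Q, ?_, rfl⟩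
    rcases isPathFrom_iff_snoc.1 hQ with ⟨h, -⟩ | ⟨w, l', h1, h2, rfl⟩
    · cases h
    refine ⟨w, ?_, l', h2, rfl⟩
    obtain ⟨l₀, rfl⟩ := List.getLast?_eq_some_iff.1 h2.2.2
    obtain ⟨K', rfl⟩ := List.head?_eq_some_iff.1 hK.2.1
    have hsteps : steps (l₀ ++ [w] ++ [CVertex.sq s k] ++ (CVertex.sq s k :: K').tail) =
        steps (l₀ ++ [w]) ++ (w, CVertex.sq s k) :: steps (CVertex.sq s k :: K') := by
      simp only [List.tail_cons, List.append_assoc, List.cons_append, List.nil_append]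
      rw [steps_append l₀ (CVertex.sq s k :: K') w]
      rfl
    rw [hsteps, List.mem_append, List.mem_cons] at hstep
    rcases hstep with h | h | h
    · exact absurd (h2.height_le (mem_of_mem_steps h).2) (not_le.2 h1.height_lt)
    · cases h
      exact ⟨h1, hr.ne⟩
    · rcases hrow _ (mem_of_mem_steps h).1 with ⟨c, h⟩ | h
      · cases h
        exact absurd hr (lt_irrefl _)
      · cases h
  · rintro ⟨K, ⟨hK, hrow⟩, Q, ⟨w, hw, l', hl', rfl⟩, rfl⟩
    have hQ : IsPathFrom white (.row i) (.sq s k) (l' ++ [.sq s k]) :=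
      isPathFrom_iff_snoc.2 (Or.inr ⟨w, l', hw.1, hl', rfl⟩)
    obtain ⟨r, hr, rfl⟩ := exists_of_mem_vertPred hw
    refine ⟨hQ.append hK, ⟨_, K, rfl, hQ, hK, hrow⟩, r, hr, ?_⟩
    obtain ⟨l₀, rfl⟩ := List.getLast?_eq_some_iff.1 hl'.2.2
    simp only [List.append_assoc, List.cons_append, List.nil_append]
    rw [steps_append l₀ (CVertex.sq s k :: K.tail) (CVertex.sq r k)]
    simp [steps]

end LastRow

/-- at step `(m,k)` (with `(1,1) ≺ (m,k)`), for `i ≤ m-1` and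
`j ≤ k-1` (1-indexed), the entry `T^{(m,k)}[i,j]` is obtained from
`T^{(m,k)⁻}[i,j]` by adding the weights of all paths `r_i ⇒ c_j` which contain
the subpath `K_j : (m,k) ⇒ c_j` along row `m` and enter `(m,k)` vertically.
(Here the diagram has `m+1` rows, `Fin.last m` being row `m+1`-st... i.e. the
last row, and indices are 0-indexed.) -/
theorem launois_step_adds_path_weights {R : Type u} [Ring R] {m n : ℕ}
    (D : QMData R (m + 1) n) (white : Fin (m + 1) → Fin n → Bool)
    (hC : IsCauchon white) (k : Fin n) (hpos : 1 ≤ m * n + (k : ℕ))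
    (i : Fin (m + 1)) (hi : (i : ℕ) < m) (j : Fin n) (hj : (j : ℕ) < (k : ℕ)) :
    launoisStep D white (m * n + (k : ℕ)) i j =
      launoisStep D white (m * n + (k : ℕ) - 1) i j +
        ∑ᶠ P : {l : List (CVertex (m + 1) n) //
            IsPathFrom white (.row i) (.col j) l ∧
            (∃ Q Kj : List (CVertex (m + 1) n),
              l = Q ++ Kj.tail ∧
              IsPathFrom white (.row i) (.sq (Fin.last m) k) Q ∧
              IsPathFrom white (.sq (Fin.last m) k) (.col j) Kj ∧
              ∀ v ∈ Kj, (∃ j' : Fin n, v = CVertex.sq (Fin.last m) j') ∨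
                v = CVertex.col j) ∧
            (∃ l' : Fin (m + 1), l' < Fin.last m ∧
              (CVertex.sq l' k, CVertex.sq (Fin.last m) k) ∈ steps l)},
          pathWeight D P.1 := by
  have his : i < Fin.last m := Fin.lt_def.2 (by simpa using hi)
  have hstep := rowState_succ_eq D white (Fin.last m) k i his j
  have hsum := finsum_set_coe_eq_finsum_mem (M := R) (f := pathWeight D)
    {l : List (CVertex (m + 1) n) | IsPathFrom white (.row i) (.col j) l ∧
        (∃ Q K : List (CVertex (m + 1) n), l = Q ++ K.tail ∧
          IsPathFrom white (.row i) (.sq (Fin.last m) k) Q ∧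
          IsPathFrom white (.sq (Fin.last m) k) (.col j) K ∧
          ∀ v ∈ K, (∃ c : Fin n, v = CVertex.sq (Fin.last m) c) ∨ v = CVertex.col j) ∧
        ∃ r : Fin (m + 1), r < Fin.last m ∧
          (CVertex.sq r k, CVertex.sq (Fin.last m) k) ∈ steps l}
  refine hstep.trans (congrArg₂ (· + ·) rfl (Eq.trans ?_ hsum.symm))
  rw [setOf_vertical_then_row_eq]
  by_cases hk : white (Fin.last m) k = true
  swap
  · have hv : vertPred white (.sq (Fin.last m) k) = ∅ :=
      Set.eq_empty_of_forall_notMem fun w hw => hk hw.1.white_of_sq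
    simp [hk, hv]
  by_cases hwj : white (Fin.last m) j = true
  swap
  · rw [rowTails_of_black (by simpa using hwj)]
    simp [hwj]
  obtain ⟨K₀, hK₀, hw⟩ := rowTails_eq_singleton D (s := Fin.last m) (Fin.le_def.2 hj.le) hk hwj
    fun l hl => absurd hl (not_lt.2 (Fin.le_last l))
  have hK₀' : K₀ ∈ rowTails white (Fin.last m) k j := hK₀ ▸ Set.mem_singleton K₀
  have hvert := finsum_vertPred_sq D white i (Fin.last m) k hk
    fun r _ hr => pathSum_row_sq D white i r k hr
  have hfin : (⋃ w ∈ vertPred white (.sq (Fin.last m) k),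
      (· ++ [CVertex.sq (Fin.last m) k]) '' pathsBetween white (.row i) w).Finite :=
    (Set.toFinite _).biUnion fun w _ => (finite_pathsBetween _ w).image _
  rw [hK₀, Set.biUnion_singleton, finsum_mem_image (List.append_left_injective _).injOn]
  rw [finsum_mem_congr rfl (g := fun Q => pathWeight D Q * pathWeight D K₀),
    ← finsum_mem_mul' _ _ hfin, finsum_snoc, hvert, hw, if_pos his, if_pos ⟨Fin.lt_def.2 hj, hk⟩,
    if_pos hwj, mul_assoc]
  intro Q hQ
  simp only [Set.mem_iUnion, Set.mem_image, exists_prop] at hQ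
  obtain ⟨w, hw, l, hl, rfl⟩ := hQ
  exact pathWeight_append_tail D
    (isPathFrom_iff_snoc.2 (Or.inr ⟨w, l, hw.1, hl, rfl⟩)) hK₀'.1
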